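/- Let p, q, r be nonzero real numbers and fix n ≥ 2. The map (A,B,C) ↦ Tr[A^{q/2} B^p A^{q/2} C^r] on triples of n×n positive definite complex matrices is jointly convex if and only if q = 2, p < 0, r < 0, and −1 ≤ p + r < 0. -/

import Mathlib

open Matrix
open scoped ComplexOrder

/-- Real power of a matrix, defined via the spectral decomposition when the matrix is
Hermitian (junk value `0` otherwise). For a positive (semi-)definite matrix this is the
usual real power given by the spectral functional calculus (with `0 ^ r = 0`). -/
noncomputable def mpow {n : ℕ} (A : Matrix (Fin n) (Fin n) ℂ) (r : ℝ) :
    Matrix (Fin n) (Fin n) ℂ :=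
  if h : A.IsHermitian then
    (h.eigenvectorUnitary : Matrix (Fin n) (Fin n) ℂ) *
      Matrix.diagonal (fun i => ((h.eigenvalues i ^ r : ℝ) : ℂ)) *
      (star h.eigenvectorUnitary : Matrix (Fin n) (Fin n) ℂ)
  else 0

/-- `Tr[A^{q/2} B^p A^{q/2} C^r]` (as a real number). -/
noncomputable def trTriple {n : ℕ} (p q r : ℝ) (A B C : Matrix (Fin n) (Fin n) ℂ) : ℝ :=
  (Matrix.trace (mpow A (q / 2) * mpow B p * mpow A (q / 2) * mpow C r)).re

/-- Joint convexity of a real-valued function of three positive definite matrices. -/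
def JointlyConvex3 {n : ℕ}
    (f : Matrix (Fin n) (Fin n) ℂ → Matrix (Fin n) (Fin n) ℂ → Matrix (Fin n) (Fin n) ℂ → ℝ) :
    Prop :=
  ∀ A₁ A₂ B₁ B₂ C₁ C₂ : Matrix (Fin n) (Fin n) ℂ,
    A₁.PosDef → A₂.PosDef → B₁.PosDef → B₂.PosDef → C₁.PosDef → C₂.PosDef →
    ∀ t : ℝ, 0 ≤ t → t ≤ 1 →
      f (t • A₁ + (1 - t) • A₂) (t • B₁ + (1 - t) • B₂) (t • C₁ + (1 - t) • C₂) ≤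
        t * f A₁ B₁ C₁ + (1 - t) * f A₂ B₂ C₂

/-- Joint concavity of a real-valued function of three positive definite matrices. -/
def JointlyConcave3 {n : ℕ}
    (f : Matrix (Fin n) (Fin n) ℂ → Matrix (Fin n) (Fin n) ℂ → Matrix (Fin n) (Fin n) ℂ → ℝ) :
    Prop :=
  ∀ A₁ A₂ B₁ B₂ C₁ C₂ : Matrix (Fin n) (Fin n) ℂ,
    A₁.PosDef → A₂.PosDef → B₁.PosDef → B₂.PosDef → C₁.PosDef → C₂.PosDef →
    ∀ t : ℝ, 0 ≤ t → t ≤ 1 →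
      t * f A₁ B₁ C₁ + (1 - t) * f A₂ B₂ C₂ ≤
        f (t • A₁ + (1 - t) • A₂) (t • B₁ + (1 - t) • B₂) (t • C₁ + (1 - t) • C₂)

open Filter Topology
open scoped Kronecker

section RealPowers

variable {n : ℕ} {A : Matrix (Fin n) (Fin n) ℂ}

lemma mpow_eq_cfc (hA : A.IsHermitian) (r : ℝ) : mpow A r = cfc (fun x : ℝ => x ^ r) A := by
  rw [hA.cfc_eq, IsHermitian.cfc, mpow, dif_pos hA]
  rfl

lemma isHermitian_mpow (A : Matrix (Fin n) (Fin n) ℂ) (r : ℝ) : (mpow A r).IsHermitian := by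
  by_cases hA : A.IsHermitian
  · rw [mpow_eq_cfc hA]
    exact cfc_predicate (p := IsSelfAdjoint) _ A
  · rw [mpow, dif_neg hA]
    exact isHermitian_zero

lemma pos_of_mem_spectrum (hA : A.PosDef) {x : ℝ} (hx : x ∈ spectrum ℝ A) : 0 < x := by
  rw [hA.isHermitian.spectrum_real_eq_range_eigenvalues] at hx
  obtain ⟨i, rfl⟩ := hx
  exact hA.eigenvalues_pos i

lemma continuousOn_rpow_spectrum (hA : A.PosDef) (r : ℝ) :
    ContinuousOn (fun x : ℝ => x ^ r) (spectrum ℝ A) := fun x hx =>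
  (Real.continuousAt_rpow_const x r (Or.inl (pos_of_mem_spectrum hA hx).ne')).continuousWithinAt

lemma mpow_add (hA : A.PosDef) (r s : ℝ) : mpow A (r + s) = mpow A r * mpow A s := by
  have hA' : IsSelfAdjoint A := hA.isHermitian
  rw [mpow_eq_cfc hA.isHermitian, mpow_eq_cfc hA.isHermitian, mpow_eq_cfc hA.isHermitian,
    ← cfc_mul _ _ A (continuousOn_rpow_spectrum hA r) (continuousOn_rpow_spectrum hA s)]
  exact cfc_congr fun x hx => Real.rpow_add (pos_of_mem_spectrum hA hx) r s

lemma mpow_one (hA : A.PosDef) : mpow A 1 = A := by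
  have hA' : IsSelfAdjoint A := hA.isHermitian
  rw [mpow_eq_cfc hA.isHermitian]
  simp_rw [Real.rpow_one]
  exact cfc_id' ℝ A

lemma mpow_zero (hA : A.PosDef) : mpow A 0 = 1 := by
  have hA' : IsSelfAdjoint A := hA.isHermitian
  rw [mpow_eq_cfc hA.isHermitian]
  simp_rw [Real.rpow_zero]
  exact cfc_const_one ℝ A

lemma mpow_posDef (hA : A.PosDef) (r : ℝ) : (mpow A r).PosDef := by
  have h : mpow A r = (mpow A (r / 2))ᴴ * mpow A (r / 2) := by
    rw [(isHermitian_mpow A _).eq, ← mpow_add hA, add_halves]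
  rw [h]
  refine PosDef.conjTranspose_mul_self _ (mulVec_injective_of_isUnit ?_)
  refine IsUnit.of_mul_eq_one (mpow A (-(r / 2))) ?_
  rw [← mpow_add hA, add_neg_cancel, mpow_zero hA]

lemma mpow_mpow_inv (hA : A.PosDef) {r : ℝ} (hr : r ≠ 0) : mpow (mpow A r⁻¹) r = A := by
  have hA' : IsSelfAdjoint A := hA.isHermitian
  have himg : ContinuousOn (fun x : ℝ => x ^ r) ((fun x : ℝ => x ^ r⁻¹) '' spectrum ℝ A) := by
    rintro _ ⟨x, hx, rfl⟩
    exact (Real.continuousAt_rpow_const _ r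
      (Or.inl (Real.rpow_pos_of_pos (pos_of_mem_spectrum hA hx) _).ne')).continuousWithinAt
  rw [mpow_eq_cfc (isHermitian_mpow A _), mpow_eq_cfc hA.isHermitian,
    ← cfc_comp' (fun x : ℝ => x ^ r) (fun x : ℝ => x ^ r⁻¹) A himg
      (continuousOn_rpow_spectrum hA _)]
  conv_rhs => rw [← cfc_id' ℝ A]
  exact cfc_congr fun x hx => Real.rpow_inv_rpow (pos_of_mem_spectrum hA hx).le hr

lemma mpow_diagonal (a : Fin n → ℝ) (r : ℝ) :
    mpow (diagonal fun i => (a i : ℂ)) r = diagonal fun i => ((a i ^ r : ℝ) : ℂ) := by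
  have hA : (diagonal fun i => (a i : ℂ)).IsHermitian := by
    simp [IsHermitian, diagonal_conjTranspose, Pi.star_def]
  rw [mpow, dif_pos hA]
  have hU : (hA.eigenvectorUnitary : Matrix (Fin n) (Fin n) ℂ) *
      (star hA.eigenvectorUnitary : Matrix (Fin n) (Fin n) ℂ) = 1 :=
    Unitary.coe_mul_star_self _
  have hU' : (star hA.eigenvectorUnitary : Matrix (Fin n) (Fin n) ℂ) *
      (hA.eigenvectorUnitary : Matrix (Fin n) (Fin n) ℂ) = 1 :=
    Unitary.coe_star_mul_self _
  have hspec := hA.spectral_theorem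
  rw [Unitary.conjStarAlgAut_apply] at hspec
  set U := (hA.eigenvectorUnitary : Matrix (Fin n) (Fin n) ℂ) with hUdef
  have hcomm : (diagonal fun i => (a i : ℂ)) * U =
      U * diagonal (RCLike.ofReal ∘ hA.eigenvalues) := by
    conv_lhs => rw [hspec]
    rw [Matrix.mul_assoc, hU', Matrix.mul_one]
  have hpow : (diagonal fun i => ((a i ^ r : ℝ) : ℂ)) * U =
      U * diagonal (fun i => ((hA.eigenvalues i ^ r : ℝ) : ℂ)) := by
    ext i j
    have h := congr_fun (congr_fun hcomm i) j
    rw [diagonal_mul, mul_diagonal] at h ⊢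
    by_cases h0 : U i j = 0
    · simp [h0]
    · have h1 : a i = hA.eigenvalues j := by
        rw [mul_comm] at h
        have := mul_left_cancel₀ h0 h
        simpa using this
      rw [h1, mul_comm]
  rw [← hpow, Matrix.mul_assoc, hU, Matrix.mul_one]

lemma continuous_mpow (hA : A.PosDef) : Continuous fun r : ℝ => mpow A r := by
  simp_rw [mpow, dif_pos hA.isHermitian]
  refine (continuous_const.matrix_mul (Continuous.matrix_diagonal ?_)).matrix_mul continuous_const
  exact continuous_pi fun i => Complex.continuous_ofReal.comp
    (Real.continuous_const_rpow (hA.eigenvalues_pos i).ne')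

end RealPowers

lemma posDef_convexComb {m : Type*} {A B : Matrix m m ℂ} (hA : A.PosDef) (hB : B.PosDef) {t : ℝ}
    (h0 : 0 ≤ t) (h1 : t ≤ 1) : (t • A + (1 - t) • B).PosDef := by
  rcases h0.eq_or_lt with rfl | h0
  · simpa using hB
  rcases h1.eq_or_lt with rfl | h1
  · simpa using hA
  · exact (hA.smul h0).add (hB.smul (sub_pos.2 h1))

section HermitianGroup

variable {m V : Type*} [Fintype m] [AddCommGroup V]

/-- The real part of the sesquilinear form of a matrix. -/
noncomputable def reForm (M : Matrix m m ℂ) (u v : m → ℂ) : ℝ := (star u ⬝ᵥ M *ᵥ v).re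

lemma reForm_mul_mul {L : Matrix m m ℂ} (hL : L.IsHermitian) (M R : Matrix m m ℂ)
    (u v : m → ℂ) : reForm (L * M * R) u v = reForm M (L *ᵥ u) (R *ᵥ v) := by
  rw [reForm, reForm, star_mulVec, hL.eq, ← dotProduct_mulVec, mulVec_mulVec, mulVec_mulVec,
    Matrix.mul_assoc]

lemma reForm_add (M N : Matrix m m ℂ) (u v : m → ℂ) :
    reForm (M + N) u v = reForm M u v + reForm N u v := by
  simp [reForm, add_mulVec]

lemma reForm_smul (t : ℝ) (M : Matrix m m ℂ) (u v : m → ℂ) :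
    reForm (t • M) u v = t * reForm M u v := by
  simp [reForm, smul_mulVec, dotProduct_smul]

variable [DecidableEq m]

lemma reForm_one_nonneg (u : m → ℂ) : 0 ≤ reForm 1 u u := by
  rw [reForm, one_mulVec]
  exact (Complex.nonneg_iff.1 (dotProduct_star_self_nonneg u)).1

lemma reForm_one_pos {u : m → ℂ} (hu : u ≠ 0) : 0 < reForm 1 u u := by
  rw [reForm, one_mulVec]
  exact (Complex.pos_iff.1 (dotProduct_star_self_pos_iff.2 hu)).1

lemma reForm_one_comm (u v : m → ℂ) : reForm 1 u v = reForm 1 v u := by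
  rw [reForm, reForm, one_mulVec, one_mulVec, star_dotProduct u v]
  exact Complex.conj_re _

lemma two_mul_reForm_one_le (u v : m → ℂ) :
    2 * reForm 1 u v ≤ reForm 1 u u + reForm 1 v v := by
  have h := reForm_one_nonneg (u - v)
  have hc := reForm_one_comm u v
  simp only [reForm, one_mulVec, star_sub, sub_dotProduct, dotProduct_sub, Complex.sub_re] at h hc ⊢
  linarith

variable {E : V → Matrix m m ℂ}

lemma two_mul_reForm_add_le (hE : ∀ x, (E x).IsHermitian)
    (hadd : ∀ x y, E (x + y) = E x * E y) (x y : V) (u v : m → ℂ) :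
    2 * reForm (E (x + y)) u v ≤ reForm (E (x + x)) u u + reForm (E (y + y)) v v := by
  have h : ∀ (x y : V) (u v : m → ℂ), reForm (E (x + y)) u v = reForm 1 (E x *ᵥ u) (E y *ᵥ v) := by
    intro x y u v
    rw [← reForm_mul_mul (hE x), Matrix.mul_one, hadd]
  simp only [h]
  exact two_mul_reForm_one_le _ _

/-- Among Hermitian `X` such that the block matrix with rows `(M, X)` and `(X, N)` is positive
semidefinite, the geometric mean of the commuting matrices `M` and `N` is the largest. -/
lemma reForm_le_geometric_mean (hE : ∀ x, (E x).IsHermitian) (h0 : E 0 = 1)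
    (hadd : ∀ x y, E (x + y) = E x * E y) {X : Matrix m m ℂ} (hX : X.IsHermitian) (a b : V)
    (h : ∀ u v, 2 * reForm X u v ≤
      reForm (E (a + a + (a + a))) u u + reForm (E (b + b + (b + b))) v v) (w : m → ℂ) :
    reForm X w w ≤ reForm (E (a + b + (a + b))) w w := by
  obtain ⟨c, hc⟩ : ∃ c, c = a + b := ⟨_, rfl⟩
  rw [← hc]
  obtain ⟨Y, hY⟩ : ∃ Y, Y = E (-c) * X * E (-c) := ⟨_, rfl⟩
  have hYX : X = E c * Y * E c := by
    simp only [hY, ← Matrix.mul_assoc, ← hadd]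
    rw [add_neg_cancel, h0, Matrix.one_mul, Matrix.mul_assoc, ← hadd, neg_add_cancel, h0,
      Matrix.mul_one]
  have hZ : (1 - Y).IsHermitian := by
    refine isHermitian_one.sub ?_
    have := isHermitian_mul_mul_conjTranspose (E (-c)) hX
    rwa [(hE (-c)).eq, ← hY] at this
  have hZpos : (1 - Y).PosSemidef := by
    rw [hZ.posSemidef_iff_eigenvalues_nonneg]
    intro i
    set z : m → ℂ := (hZ.eigenvectorBasis i).ofLp with hz
    set μ := hZ.eigenvalues i with hμ
    have hz0 : z ≠ 0 := by
      intro h0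
      have h1 := hZ.eigenvectorBasis.orthonormal.ne_zero i
      exact h1 (by ext j; exact congr_fun h0 j)
    have hYz : Y *ᵥ z = (1 - μ) • z := by
      have h1 := hZ.mulVec_eigenvectorBasis i
      rw [sub_mulVec, one_mulVec] at h1
      rw [sub_smul, one_smul, ← h1, sub_sub_cancel]
    obtain ⟨d, hd⟩ : ∃ d, d = E (b - a) *ᵥ z := ⟨_, rfl⟩
    have hd0 : d ≠ 0 := by
      intro h2
      apply hz0
      have : E (a - b) *ᵥ d = z := by
        rw [hd, mulVec_mulVec, ← hadd, sub_add_sub_cancel, sub_self, h0, one_mulVec]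
      rw [← this, h2, mulVec_zero]
    have h1 := h (E (-(a + a)) *ᵥ d) (E (-(b + b)) *ᵥ d)
    rw [← reForm_mul_mul (hE _), ← reForm_mul_mul (hE _), ← reForm_mul_mul (hE _), ← hadd, ← hadd,
      ← hadd, ← hadd, show -(a + a) + (a + a + (a + a)) + -(a + a) = 0 by abel,
      show -(b + b) + (b + b + (b + b)) + -(b + b) = 0 by abel, h0] at h1
    have h3 : reForm (E (-(a + a)) * X * E (-(b + b))) d d = (1 - μ) * reForm 1 d d := by
      have h4 : (E (-(a + a)) * X * E (-(b + b))) *ᵥ d = (1 - μ) • d := by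
        rw [hYX, hd, mulVec_mulVec]
        calc (E (-(a + a)) * (E c * Y * E c) * E (-(b + b)) * E (b - a)) *ᵥ z
            = ((E (-(a + a)) * E c) * Y * (E c * E (-(b + b)) * E (b - a))) *ᵥ z := by
              simp only [Matrix.mul_assoc]
          _ = (E (b - a) * Y) *ᵥ z := by
              rw [← hadd, ← hadd, ← hadd, hc, show a + b + -(b + b) + (b - a) = 0 by abel,
                show -(a + a) + (a + b) = b - a by abel, h0, Matrix.mul_one]
          _ = _ := by rw [← mulVec_mulVec, hYz, mulVec_smul]
      rw [reForm, h4, reForm, one_mulVec, dotProduct_smul, Complex.smul_re, smul_eq_mul]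
    rw [h3] at h1
    have h5 := reForm_one_pos hd0
    change 0 ≤ μ
    by_contra hneg
    push Not at hneg
    nlinarith
  have h6 := (hZpos.dotProduct_mulVec_nonneg (E c *ᵥ w))
  rw [sub_mulVec, dotProduct_sub] at h6
  have h7 := (Complex.nonneg_iff.1 h6).1
  rw [Complex.sub_re, sub_nonneg] at h7
  rw [hYX, reForm_mul_mul (hE _), hadd, ← Matrix.mul_one (E c),
    reForm_mul_mul (hE _), Matrix.mul_one]
  exact h7

end HermitianGroup

section Lieb

variable {n : ℕ}

/-- The matrix of the map `K ↦ B ^ x.1 * K * C ^ x.2` in the coordinates given by `Matrix.vec`. -/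
noncomputable def kronPow (B C : Matrix (Fin n) (Fin n) ℂ) (x : ℝ × ℝ) :
    Matrix (Fin n × Fin n) (Fin n × Fin n) ℂ :=
  (mpow C x.2)ᵀ ⊗ₖ mpow B x.1

lemma isHermitian_kronPow (B C : Matrix (Fin n) (Fin n) ℂ) (x : ℝ × ℝ) :
    (kronPow B C x).IsHermitian := by
  rw [IsHermitian, kronPow, conjTranspose_kronecker, (isHermitian_mpow C _).transpose.eq,
    (isHermitian_mpow B _).eq]

lemma kronPow_add {B C : Matrix (Fin n) (Fin n) ℂ} (hB : B.PosDef) (hC : C.PosDef) (x y : ℝ × ℝ) :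
    kronPow B C (x + y) = kronPow B C x * kronPow B C y := by
  rw [kronPow, kronPow, kronPow, ← mul_kronecker_mul, ← transpose_mul, ← mpow_add hB, ← mpow_add hC,
    Prod.fst_add, Prod.snd_add, add_comm x.2]

lemma kronPow_zero {B C : Matrix (Fin n) (Fin n) ℂ} (hB : B.PosDef) (hC : C.PosDef) :
    kronPow B C 0 = 1 := by
  rw [kronPow, Prod.fst_zero, Prod.snd_zero, mpow_zero hB, mpow_zero hC, transpose_one,
    one_kronecker_one]

lemma continuous_kronPow {B C : Matrix (Fin n) (Fin n) ℂ} (hB : B.PosDef) (hC : C.PosDef) :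
    Continuous (kronPow B C) := by
  refine continuous_matrix fun i j => ?_
  exact (((continuous_mpow hC).comp continuous_snd).matrix_elem _ _).mul
    (((continuous_mpow hB).comp continuous_fst).matrix_elem _ _)

/-- The pairs `x` for which `(B, C) ↦ Re Tr (Kᴴ * B ^ x.1 * K * C ^ x.2)` is jointly concave
for every `K`. -/
def liebSet (n : ℕ) : Set (ℝ × ℝ) :=
  {x | ∀ B₁ B₂ C₁ C₂ : Matrix (Fin n) (Fin n) ℂ, B₁.PosDef → B₂.PosDef → C₁.PosDef → C₂.PosDef →
    ∀ t : ℝ, 0 ≤ t → t ≤ 1 → ∀ w : Fin n × Fin n → ℂ,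
      t * reForm (kronPow B₁ C₁ x) w w + (1 - t) * reForm (kronPow B₂ C₂ x) w w ≤
        reForm (kronPow (t • B₁ + (1 - t) • B₂) (t • C₁ + (1 - t) • C₂) x) w w}

lemma isClosed_liebSet (n : ℕ) : IsClosed (liebSet n) := by
  simp only [liebSet, Set.ofPred_forall]
  repeat refine isClosed_iInter fun _ => ?_
  rename_i B₁ B₂ C₁ C₂ hB₁ hB₂ hC₁ hC₂ t h0 h1 w
  have hcont : ∀ {B C : Matrix (Fin n) (Fin n) ℂ}, B.PosDef → C.PosDef →
      Continuous fun x => reForm (kronPow B C x) w w := fun hB hC =>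
    Complex.continuous_re.comp
      (continuous_const.dotProduct ((continuous_kronPow hB hC).matrix_mulVec continuous_const))
  exact isClosed_le ((continuous_const.mul (hcont hB₁ hC₁)).add
    (continuous_const.mul (hcont hB₂ hC₂)))
    (hcont (posDef_convexComb hB₁ hB₂ h0 h1) (posDef_convexComb hC₁ hC₂ h0 h1))

lemma midpoint_mem_liebSet {x y : ℝ × ℝ} (hx : x ∈ liebSet n) (hy : y ∈ liebSet n) :
    midpoint ℝ x y ∈ liebSet n := by
  intro B₁ B₂ C₁ C₂ hB₁ hB₂ hC₁ hC₂ t h0 h1 w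
  set a := (1 / 4 : ℝ) • x with ha
  set b := (1 / 4 : ℝ) • y with hb
  have hxa : x = a + a + (a + a) := by rw [ha]; module
  have hyb : y = b + b + (b + b) := by rw [hb]; module
  have hmid : midpoint ℝ x y = a + b + (a + b) := by
    rw [midpoint_eq_smul_add, invOf_eq_inv, ha, hb]; module
  have hB := posDef_convexComb hB₁ hB₂ h0 h1
  have hC := posDef_convexComb hC₁ hC₂ h0 h1
  have key := reForm_le_geometric_mean (isHermitian_kronPow _ _) (kronPow_zero hB hC)
    (kronPow_add hB hC) (X := t • kronPow B₁ C₁ (midpoint ℝ x y) +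
      (1 - t) • kronPow B₂ C₂ (midpoint ℝ x y)) ?_ a b ?_ w
  · rwa [reForm_add, reForm_smul, reForm_smul, ← hmid] at key
  · have hsmul : ∀ (t : ℝ) {M : Matrix (Fin n × Fin n) (Fin n × Fin n) ℂ}, M.IsHermitian →
        (t • M).IsHermitian := fun t M hM => by
      rw [IsHermitian, conjTranspose_smul, hM.eq, star_trivial]
    exact (hsmul t (isHermitian_kronPow _ _ _)).add (hsmul _ (isHermitian_kronPow _ _ _))
  · intro u v
    have hux := hx B₁ B₂ C₁ C₂ hB₁ hB₂ hC₁ hC₂ t h0 h1 u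
    have hvy := hy B₁ B₂ C₁ C₂ hB₁ hB₂ hC₁ hC₂ t h0 h1 v
    have h2 : ∀ {B C : Matrix (Fin n) (Fin n) ℂ}, B.PosDef → C.PosDef →
        2 * reForm (kronPow B C (midpoint ℝ x y)) u v ≤
          reForm (kronPow B C x) u u + reForm (kronPow B C y) v v := by
      intro B C hB hC
      have := two_mul_reForm_add_le (isHermitian_kronPow B C) (kronPow_add hB hC) (a + a) (b + b) u v
      rwa [← hxa, ← hyb, add_add_add_comm, ← hmid] at this
    have e1 := mul_le_mul_of_nonneg_left (h2 hB₁ hC₁) h0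
    have e2 := mul_le_mul_of_nonneg_left (h2 hB₂ hC₂) (sub_nonneg.2 h1)
    rw [reForm_add, reForm_smul, reForm_smul, ← hxa, ← hyb]
    linarith

lemma zero_mem_liebSet (n : ℕ) : (0 : ℝ × ℝ) ∈ liebSet n := by
  intro B₁ B₂ C₁ C₂ hB₁ hB₂ hC₁ hC₂ t h0 h1 w
  rw [kronPow_zero hB₁ hC₁, kronPow_zero hB₂ hC₂, kronPow_zero (posDef_convexComb hB₁ hB₂ h0 h1)
    (posDef_convexComb hC₁ hC₂ h0 h1)]
  exact le_of_eq (by ring)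

lemma fst_mem_liebSet (n : ℕ) : ((1, 0) : ℝ × ℝ) ∈ liebSet n := by
  intro B₁ B₂ C₁ C₂ hB₁ hB₂ hC₁ hC₂ t h0 h1 w
  have hB := posDef_convexComb hB₁ hB₂ h0 h1
  have hC := posDef_convexComb hC₁ hC₂ h0 h1
  simp only [kronPow, mpow_one hB₁, mpow_one hB₂, mpow_one hB, mpow_zero hC₁, mpow_zero hC₂,
    mpow_zero hC]
  rw [kronecker_add, kronecker_smul, kronecker_smul, reForm_add, reForm_smul, reForm_smul]

lemma snd_mem_liebSet (n : ℕ) : ((0, 1) : ℝ × ℝ) ∈ liebSet n := by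
  intro B₁ B₂ C₁ C₂ hB₁ hB₂ hC₁ hC₂ t h0 h1 w
  have hB := posDef_convexComb hB₁ hB₂ h0 h1
  have hC := posDef_convexComb hC₁ hC₂ h0 h1
  simp only [kronPow, mpow_one hC₁, mpow_one hC₂, mpow_one hC, mpow_zero hB₁, mpow_zero hB₂,
    mpow_zero hB]
  rw [transpose_add, transpose_smul, transpose_smul, add_kronecker, smul_kronecker, smul_kronecker,
    reForm_add, reForm_smul, reForm_smul]

/-- A closed set of real numbers that is closed under midpoints is convex. -/
lemma ordConnected_of_midpoint {T : Set ℝ} (hT : IsClosed T)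
    (hmid : ∀ x ∈ T, ∀ y ∈ T, midpoint ℝ x y ∈ T) : T.OrdConnected := by
  refine ⟨fun x hx y hy z hz => ?_⟩
  by_contra hzT
  have hc1 : IsCompact (T ∩ Set.Icc x z) := isCompact_Icc.inter_left hT
  have hc2 : IsCompact (T ∩ Set.Icc z y) := isCompact_Icc.inter_left hT
  obtain ⟨a, ⟨haT, ha⟩, hamax⟩ := hc1.exists_isGreatest ⟨x, hx, le_rfl, hz.1⟩
  obtain ⟨b, ⟨hbT, hb⟩, hbmin⟩ := hc2.exists_isLeast ⟨y, hy, hz.2, le_rfl⟩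
  have haz : a < z := lt_of_le_of_ne ha.2 fun h => hzT (h ▸ haT)
  have hzb : z < b := lt_of_le_of_ne hb.1 fun h => hzT (h ▸ hbT)
  have hm := hmid a haT b hbT
  have hmeq : midpoint ℝ a b = (a + b) / 2 := by
    rw [midpoint_eq_smul_add, invOf_eq_inv, smul_eq_mul]; ring
  rw [hmeq] at hm
  rcases le_total ((a + b) / 2) z with h | h
  · have := hamax ⟨hm, by linarith [ha.1], h⟩
    linarith
  · have := hbmin ⟨hm, h, by linarith [hb.2]⟩
    linarith

lemma convex_of_midpoint {F : Type*} [AddCommGroup F] [Module ℝ F] [TopologicalSpace F]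
    [IsTopologicalAddGroup F] [ContinuousSMul ℝ F] {S : Set F} (hS : IsClosed S)
    (hmid : ∀ x ∈ S, ∀ y ∈ S, midpoint ℝ x y ∈ S) : Convex ℝ S := by
  rw [convex_iff_segment_subset]
  intro x hx y hy
  rw [segment_eq_image_lineMap]
  rintro _ ⟨t, ht, rfl⟩
  have hcont : Continuous fun t : ℝ => AffineMap.lineMap x y t := by
    simp only [AffineMap.lineMap_apply_module]
    fun_prop
  have hT := ordConnected_of_midpoint (hS.preimage hcont) fun a ha b hb => by
    rw [Set.mem_preimage, AffineMap.map_midpoint]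
    exact hmid _ ha _ hb
  exact hT.out (by simpa using hx) (by simpa using hy) ht

/-- **Lieb's concavity theorem**. -/
lemma mem_liebSet {s t : ℝ} (hs : 0 ≤ s) (ht : 0 ≤ t) (hst : s + t ≤ 1) : (s, t) ∈ liebSet n := by
  have h := (convex_of_midpoint (isClosed_liebSet n)
    fun _ hx _ hy => midpoint_mem_liebSet hx hy).sum_mem (t := Finset.univ)
    (w := ![s, t, 1 - s - t]) (z := ![((1, 0) : ℝ × ℝ), (0, 1), 0]) ?_ ?_ ?_
  · simpa [Fin.sum_univ_three] using h
  · intro i _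
    fin_cases i <;> simp <;> linarith
  · simp [Fin.sum_univ_three]
  · intro i _
    fin_cases i
    · exact fst_mem_liebSet n
    · exact snd_mem_liebSet n
    · exact zero_mem_liebSet n

lemma trTriple_two_eq_reForm {A : Matrix (Fin n) (Fin n) ℂ} (hA : A.PosDef) (p r : ℝ)
    (B C : Matrix (Fin n) (Fin n) ℂ) :
    trTriple p 2 r A B C = reForm (kronPow B C (p, r)) A.vec A.vec := by
  rw [trTriple, reForm, kronPow, kronecker_mulVec_vec, star_vec_dotProduct_vec, hA.isHermitian.eq,
    div_self two_ne_zero, mpow_one hA, transpose_transpose]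
  simp only [Matrix.mul_assoc]

lemma jointlyConvex3_trTriple_two {p r : ℝ} (hp : p ≤ 0) (hr : r ≤ 0) (hpr : -1 ≤ p + r) :
    JointlyConvex3 (trTriple (n := n) p 2 r) := by
  intro A₁ A₂ B₁ B₂ C₁ C₂ hA₁ hA₂ hB₁ hB₂ hC₁ hC₂ t h0 h1
  have hA := posDef_convexComb hA₁ hA₂ h0 h1
  have hB := posDef_convexComb hB₁ hB₂ h0 h1
  have hC := posDef_convexComb hC₁ hC₂ h0 h1
  rw [trTriple_two_eq_reForm hA, trTriple_two_eq_reForm hA₁, trTriple_two_eq_reForm hA₂]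
  set B := t • B₁ + (1 - t) • B₂
  set C := t • C₁ + (1 - t) • C₂
  set w := (t • A₁ + (1 - t) • A₂).vec with hw
  obtain ⟨l, hl⟩ : ∃ l, l = kronPow B C (p, r) *ᵥ w := ⟨_, rfl⟩
  have hG := mem_liebSet (n := n) (s := -p) (t := -r) (by linarith) (by linarith) (by linarith)
    B₁ B₂ C₁ C₂ hB₁ hB₂ hC₁ hC₂ t h0 h1 l
  have hGl : reForm (kronPow B C (-p, -r)) l l = reForm (kronPow B C (p, r)) w w := by
    have h := reForm_mul_mul (isHermitian_kronPow B C (p, r)) (kronPow B C (-p, -r))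
      (kronPow B C (p, r)) w w
    rw [← hl, ← kronPow_add hB hC, ← kronPow_add hB hC] at h
    rw [← h]
    congr 2
    simp
  have hlw : ∀ v, reForm 1 l v = reForm (kronPow B C (p, r)) w v := by
    intro v
    have h := reForm_mul_mul (isHermitian_kronPow B C (p, r)) 1 1 w v
    rw [← hl, Matrix.mul_one, Matrix.mul_one, one_mulVec] at h
    exact h.symm
  have hF : ∀ {B C : Matrix (Fin n) (Fin n) ℂ}, B.PosDef → C.PosDef → ∀ v,
      2 * reForm 1 l v ≤ reForm (kronPow B C (-p, -r)) l l + reForm (kronPow B C (p, r)) v v := by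
    intro B C hB hC v
    have h := two_mul_reForm_add_le (isHermitian_kronPow B C) (kronPow_add hB hC)
      (-p / 2, -r / 2) (p / 2, r / 2) l v
    have e1 : ((-p / 2, -r / 2) : ℝ × ℝ) + (p / 2, r / 2) = 0 := by
      ext <;> simp <;> ring
    have e2 : ((-p / 2, -r / 2) : ℝ × ℝ) + (-p / 2, -r / 2) = (-p, -r) := by
      ext <;> simp
    have e3 : ((p / 2, r / 2) : ℝ × ℝ) + (p / 2, r / 2) = (p, r) := by
      ext <;> simp
    rwa [e1, e2, e3, kronPow_zero hB hC] at h
  have e1 := mul_le_mul_of_nonneg_left (hF hB₁ hC₁ A₁.vec) h0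
  have e2 := mul_le_mul_of_nonneg_left (hF hB₂ hC₂ A₂.vec) (sub_nonneg.2 h1)
  have e3 : reForm 1 l w = t * reForm 1 l A₁.vec + (1 - t) * reForm 1 l A₂.vec := by
    rw [hw, vec_add, vec_smul, vec_smul]
    simp [reForm, dotProduct_add, dotProduct_smul]
  have e4 := hlw w
  linarith

end Lieb

section Necessity

variable {n : ℕ}

lemma JointlyConvex3.convexOn_line
    {f : Matrix (Fin n) (Fin n) ℂ → Matrix (Fin n) (Fin n) ℂ → Matrix (Fin n) (Fin n) ℂ → ℝ}
    (hf : JointlyConvex3 f) {S : Set ℝ} (hS : Convex ℝ S) {A B C : ℝ → Matrix (Fin n) (Fin n) ℂ}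
    (hA : ∀ t x y, A (t * x + (1 - t) * y) = t • A x + (1 - t) • A y)
    (hB : ∀ t x y, B (t * x + (1 - t) * y) = t • B x + (1 - t) • B y)
    (hC : ∀ t x y, C (t * x + (1 - t) * y) = t • C x + (1 - t) • C y)
    (hAS : ∀ x ∈ S, (A x).PosDef) (hBS : ∀ x ∈ S, (B x).PosDef) (hCS : ∀ x ∈ S, (C x).PosDef) :
    ConvexOn ℝ S fun x => f (A x) (B x) (C x) := by
  refine ⟨hS, fun x hx y hy t t' ht ht' htt' => ?_⟩
  obtain rfl : t' = 1 - t := by linarith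
  simp only [smul_eq_mul, hA, hB, hC]
  exact hf _ _ _ _ _ _ (hAS x hx) (hAS y hy) (hBS x hx) (hBS y hy) (hCS x hx) (hCS y hy) t ht
    (sub_nonneg.1 ht')

lemma ConvexOn.nonneg_of_hasDerivAt_hasDerivAt {S : Set ℝ} (hS : IsOpen S) {G G' : ℝ → ℝ} {x c : ℝ}
    (hG : ConvexOn ℝ S G) (hx : x ∈ S) (h1 : ∀ t ∈ S, HasDerivAt G (G' t) t)
    (h2 : HasDerivAt G' c x) : 0 ≤ c := by
  have hmono : MonotoneOn G' S := by
    refine (hG.monotoneOn_deriv fun t ht => (h1 t ht).differentiableAt).congr fun t ht => ?_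
    exact (h1 t ht).deriv
  have h := hmono.derivWithin_nonneg (x := x)
  rwa [h2.hasDerivWithinAt.derivWithin (hS.uniqueDiffOn x hx)] at h

/-- The diagonal matrix with real diagonal entries `1 + t * d i`. -/
noncomputable def diagLine (d : Fin n → ℝ) (t : ℝ) : Matrix (Fin n) (Fin n) ℂ :=
  diagonal fun i => ((1 + t * d i : ℝ) : ℂ)

lemma diagLine_convexComb (d : Fin n → ℝ) (t x y : ℝ) :
    diagLine d (t * x + (1 - t) * y) = t • diagLine d x + (1 - t) • diagLine d y := by
  rw [diagLine, diagLine, diagLine, ← diagonal_smul, ← diagonal_smul, diagonal_add]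
  congr 1
  ext i
  simp only [Pi.smul_apply, Complex.real_smul]
  push_cast
  ring

lemma posDef_diagLine {d : Fin n → ℝ} {t : ℝ} (h : ∀ i, 0 < 1 + t * d i) :
    (diagLine d t).PosDef := by
  rw [diagLine, posDef_diagonal_iff]
  exact fun i => Complex.zero_lt_real.2 (h i)

lemma mpow_diagLine (d : Fin n → ℝ) (t r : ℝ) :
    mpow (diagLine d t) r = diagonal fun i => (((1 + t * d i) ^ r : ℝ) : ℂ) :=
  mpow_diagonal _ r

lemma convexOn_sq_sum {p q r : ℝ} (hp : p ≠ 0) (hr : r ≠ 0)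
    (hf : JointlyConvex3 (trTriple (n := n) p q r)) (c d : Fin n → ℝ) {S : Set ℝ}
    (hS : Convex ℝ S) (hd : ∀ t ∈ S, ∀ i, 0 < 1 + t * d i) :
    ConvexOn ℝ S fun t => (∑ i, c i * (1 + t * d i) ^ (q / 2)) ^ 2 := by
  set X : ℝ → (Fin n → ℂ) → Matrix (Fin n) (Fin n) ℂ := fun ε v => vecMulVec v (star v) + ε • 1
    with hX
  have hXpos : ∀ ε > 0, ∀ v, (X ε v).PosDef := fun ε hε v =>
    PosDef.posSemidef_add (posSemidef_vecMulVec_self_star v) (PosDef.one.smul hε)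
  set D : ℝ → Matrix (Fin n) (Fin n) ℂ := fun t => mpow (diagLine d t) (q / 2) with hD
  set v : Fin n → ℂ := fun i => (c i : ℂ)
  set F : ℝ → ℝ → ℝ := fun ε t => (trace (D t * X ε v * D t * X ε 1)).re with hF
  have hconv : ∀ ε > 0, ConvexOn ℝ S (F ε) := by
    intro ε hε
    have h := hf.convexOn_line hS (A := diagLine d) (B := fun _ => mpow (X ε v) p⁻¹)
      (C := fun _ => mpow (X ε 1) r⁻¹) (diagLine_convexComb d)
      (fun t _ _ => by rw [← add_smul, add_sub_cancel, one_smul])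
      (fun t _ _ => by rw [← add_smul, add_sub_cancel, one_smul])
      (fun t ht => posDef_diagLine (hd t ht)) (fun _ _ => mpow_posDef (hXpos ε hε v) _)
      (fun _ _ => mpow_posDef (hXpos ε hε 1) _)
    simpa only [trTriple, mpow_mpow_inv (hXpos ε hε v) hp, mpow_mpow_inv (hXpos ε hε 1) hr] using h
  have hlim : ∀ t, Tendsto (fun ε => F ε t) (𝓝[>] 0) (𝓝 (F 0 t)) := by
    intro t
    refine Tendsto.mono_left (Continuous.tendsto ?_ 0) nhdsWithin_le_nhds
    simp only [hF, hX]
    fun_prop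
  have hF0 : ∀ t, F 0 t = (∑ i, c i * (1 + t * d i) ^ (q / 2)) ^ 2 := by
    intro t
    have h1 : ∀ w : Fin n → ℂ, X 0 w = vecMulVec w (star w) := fun w => by simp [hX]
    simp only [hF, h1]
    rw [Matrix.mul_assoc, mul_vecMulVec, vecMulVec_mul, ← vecMul_vecMul, vecMul_vecMulVec,
      trace_vecMulVec, dotProduct_smul]
    have hDt : D t = diagonal fun i => (((1 + t * d i) ^ (q / 2) : ℝ) : ℂ) := mpow_diagLine d t _
    have h2 : D t *ᵥ v = fun i => ((c i * (1 + t * d i) ^ (q / 2) : ℝ) : ℂ) := by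
      ext i
      rw [hDt, mulVec_diagonal, Complex.ofReal_mul, mul_comm]
    have h3 : star v ᵥ* D t = fun i => ((c i * (1 + t * d i) ^ (q / 2) : ℝ) : ℂ) := by
      ext i
      rw [hDt, vecMul_diagonal, Complex.ofReal_mul, Pi.star_apply, RCLike.star_def,
        Complex.conj_ofReal]
    rw [h2, h3, star_one, dotProduct_one, ← Complex.ofReal_sum, smul_eq_mul, ← Complex.ofReal_mul,
      Complex.ofReal_re, sq]
  refine ⟨hS, fun x hx y hy a b ha hb hab => ?_⟩
  simp only [← hF0]
  refine le_of_tendsto_of_tendsto (hlim _) (((hlim x).const_smul a).add ((hlim y).const_smul b)) ?_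
  filter_upwards [self_mem_nhdsWithin] with ε hε
  exact (hconv ε hε).2 hx hy ha hb hab

lemma one_add_mul_pos {t u : ℝ} (ht : t ∈ Set.Ioo (-(1 / 4)) (1 / 4)) (hu : u ∈ Set.Icc (-2) 2) :
    0 < 1 + t * u := by
  nlinarith [mul_nonneg (by linarith [ht.1] : 0 ≤ t + 1 / 4) (by linarith [hu.1] : 0 ≤ 2 + u),
    mul_nonneg (by linarith [ht.2] : 0 ≤ 1 / 4 - t) (by linarith [hu.2] : 0 ≤ 2 - u)]

lemma mul_nonpos_of_convexOn_sq {s u : ℝ} (hu : u ∈ Set.Icc (-2) 2)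
    (h : ConvexOn ℝ (Set.Ioo (-(1 / 4)) (1 / 4))
      fun t : ℝ => (u * (1 + t) ^ s - (1 + t * u) ^ s) ^ 2) :
    s * (s - 1) * u * (u - 1) ^ 2 ≤ 0 := by
  have hpos1 : ∀ t ∈ Set.Ioo (-(1 / 4) : ℝ) (1 / 4), 0 < 1 + t := fun t ht => by linarith [ht.1]
  have hpos2 : ∀ t ∈ Set.Ioo (-(1 / 4) : ℝ) (1 / 4), 0 < 1 + t * u := fun t ht =>
    one_add_mul_pos ht hu
  have hpow : ∀ (s v t : ℝ), 0 < 1 + t * v →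
      HasDerivAt (fun t : ℝ => (1 + t * v) ^ s) (s * v * (1 + t * v) ^ (s - 1)) t := by
    intro s v t ht
    have h1 : HasDerivAt (fun t : ℝ => 1 + t * v) v t := by
      simpa using ((hasDerivAt_id t).mul_const v).const_add 1
    convert h1.rpow_const (p := s) (Or.inl ht.ne') using 1
    ring
  have hpow1 : ∀ (s t : ℝ), 0 < 1 + t →
      HasDerivAt (fun t : ℝ => (1 + t) ^ s) (s * (1 + t) ^ (s - 1)) t := by
    intro s t ht
    simpa using hpow s 1 t (by simpa using ht)
  have hg : ∀ t ∈ Set.Ioo (-(1 / 4) : ℝ) (1 / 4),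
      HasDerivAt (fun t : ℝ => u * (1 + t) ^ s - (1 + t * u) ^ s)
        (s * u * ((1 + t) ^ (s - 1) - (1 + t * u) ^ (s - 1))) t := by
    intro t ht
    exact (((hpow1 s t (hpos1 t ht)).const_mul u).fun_sub
      (hpow s u t (hpos2 t ht))).congr_deriv (by ring)
  have h0 : (0 : ℝ) ∈ Set.Ioo (-(1 / 4) : ℝ) (1 / 4) := by norm_num
  have hg2 : HasDerivAt (fun t : ℝ => s * u * ((1 + t) ^ (s - 1) - (1 + t * u) ^ (s - 1)))
      (s * u * ((s - 1) - (s - 1) * u)) 0 := by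
    simpa using ((hpow1 (s - 1) 0 (by simp)).sub (hpow (s - 1) u 0 (by simp))).const_mul (s * u)
  have key := h.nonneg_of_hasDerivAt_hasDerivAt isOpen_Ioo h0
    (fun t ht => by simpa using (hg t ht).fun_pow 2) ((((hg 0 h0).const_mul 2).mul hg2))
  simp at key
  nlinarith

lemma eq_two_of_jointlyConvex3 {p q r : ℝ} (hp : p ≠ 0) (hq : q ≠ 0) (hr : r ≠ 0) (hn : 2 ≤ n)
    (hf : JointlyConvex3 (trTriple (n := n) p q r)) : q = 2 := by
  set i₀ : Fin n := ⟨0, by omega⟩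
  set i₁ : Fin n := ⟨1, by omega⟩
  have hne : i₁ ≠ i₀ := by simp [i₀, i₁]
  have key : ∀ u ∈ Set.Icc (-2 : ℝ) 2, q / 2 * (q / 2 - 1) * u * (u - 1) ^ 2 ≤ 0 := by
    intro u hu
    refine mul_nonpos_of_convexOn_sq hu ?_
    have h := convexOn_sq_sum hp hr hf (Pi.single i₀ u - Pi.single i₁ 1)
      (Pi.single i₀ 1 + Pi.single i₁ u) (convex_Ioo (-(1 / 4)) (1 / 4)) ?_
    · refine h.congr fun t _ => ?_
      dsimp only
      congr 1
      rw [← Finset.sum_subset (Finset.subset_univ {i₀, i₁}), Finset.sum_pair hne.symm]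
      · simp [hne, hne.symm, sub_eq_add_neg]
      · intro i _ hi
        simp only [Finset.mem_insert, Finset.mem_singleton, not_or] at hi
        simp [hi.1, hi.2]
    · intro t ht i
      by_cases h0 : i = i₀
      · subst h0
        simp [hne.symm]
        linarith [ht.1]
      · by_cases h1 : i = i₁
        · subst h1
          simp [hne]
          exact one_add_mul_pos ht hu
        · simp [h0, h1]
  have k1 := key 2 (by norm_num)
  have k2 := key (-1) (by norm_num)
  have k3 : q * (q - 2) = 0 := by nlinarith
  rcases mul_eq_zero.1 k3 with h | h
  · exact absurd h hq
  · linarith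

lemma mul_add_one_nonpos_of_convexOn {σ : ℝ}
    (h : ∀ x : ℝ, ∃ δ > 0, ConvexOn ℝ (Set.Ioo (-δ) δ) fun t : ℝ =>
      (1 + t * x) ^ 2 * (1 + t) ^ σ) : σ * (σ + 1) ≤ 0 := by
  obtain ⟨δ', hδ', hconv'⟩ := h (-σ)
  obtain ⟨δ, hδ, hδ1, hle⟩ : ∃ δ > 0, δ ≤ 1 ∧ δ ≤ δ' :=
    ⟨min δ' 1, lt_min hδ' one_pos, min_le_right _ _, min_le_left _ _⟩
  have hconv := hconv'.subset (Set.Ioo_subset_Ioo (neg_le_neg hle) hle) (convex_Ioo _ _)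
  have h0 : (0 : ℝ) ∈ Set.Ioo (-δ) δ := ⟨by linarith, hδ⟩
  have hpow : ∀ s : ℝ, ∀ t ∈ Set.Ioo (-δ) δ,
      HasDerivAt (fun t : ℝ => (1 + t) ^ s) (s * (1 + t) ^ (s - 1)) t := by
    intro s t ht
    have h1 : HasDerivAt (fun t : ℝ => 1 + t) 1 t := by simpa using (hasDerivAt_id t).const_add 1
    convert h1.rpow_const (p := s) (Or.inl (by linarith [ht.1] : (1 + t) ≠ 0)) using 1
    ring
  have hlin : ∀ t : ℝ, HasDerivAt (fun t : ℝ => 1 + t * -σ) (-σ) t := fun t => by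
    simpa using ((hasDerivAt_id t).mul_const (-σ)).const_add 1
  have hsq : ∀ t : ℝ, HasDerivAt (fun t : ℝ => (1 + t * -σ) ^ 2) (2 * (1 + t * -σ) * -σ) t :=
    fun t => by simpa using (hlin t).fun_pow 2
  have key := hconv.nonneg_of_hasDerivAt_hasDerivAt isOpen_Ioo h0
    (fun t ht => (hsq t).mul (hpow σ t ht))
    (((((hlin 0).const_mul 2).mul_const (-σ)).mul (hpow σ 0 h0)).add
      ((hsq 0).mul ((hpow (σ - 1) 0 h0).const_mul σ)))
  simp at key
  nlinarith

lemma exponents_of_jointlyConvex3 {p r : ℝ} (hn : 0 < n)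
    (hf : JointlyConvex3 (trTriple (n := n) p 2 r)) :
    p * (p + 1) ≤ 0 ∧ r * (r + 1) ≤ 0 ∧ (p + r) * (p + r + 1) ≤ 0 := by
  have key : ∀ i ∈ Set.Icc (0 : ℝ) 1, ∀ j ∈ Set.Icc (0 : ℝ) 1, ∀ x : ℝ, ∃ δ > 0, δ ≤ 1 ∧
      ConvexOn ℝ (Set.Ioo (-δ) δ) fun t : ℝ =>
        (1 + t * x) ^ 2 * ((1 + t * i) ^ p * (1 + t * j) ^ r) := by
    intro i hi j hj x
    have hx : 0 < |x| + 1 := by positivity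
    have hδ1 : 1 / (|x| + 1) ≤ 1 := by
      rw [div_le_one hx]
      linarith [abs_nonneg x]
    have hlin : ∀ y : ℝ, |y| ≤ |x| + 1 → ∀ t ∈ Set.Ioo (-(1 / (|x| + 1))) (1 / (|x| + 1)),
        0 < 1 + t * y := by
      intro y hy t ht
      have h1 : |t| * (|x| + 1) < 1 := by
        rw [← lt_div_iff₀ hx]
        exact abs_lt.2 ht
      have h2 : |t * y| ≤ |t| * (|x| + 1) := by
        rw [abs_mul]
        exact mul_le_mul_of_nonneg_left hy (abs_nonneg t)
      linarith [neg_abs_le (t * y)]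
    have hone : ∀ y ∈ Set.Icc (0 : ℝ) 1, |y| ≤ |x| + 1 := fun y hy => by
      rw [abs_of_nonneg hy.1]
      linarith [hy.2, abs_nonneg x]
    refine ⟨1 / (|x| + 1), by positivity, hδ1, ?_⟩
    have h := hf.convexOn_line (convex_Ioo (-(1 / (|x| + 1))) (1 / (|x| + 1)))
      (diagLine_convexComb fun _ => x) (diagLine_convexComb fun _ => i)
      (diagLine_convexComb fun _ => j)
      (fun t ht => posDef_diagLine fun _ => hlin x (by linarith) t ht)
      (fun t ht => posDef_diagLine fun _ => hlin i (hone i hi) t ht)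
      (fun t ht => posDef_diagLine fun _ => hlin j (hone j hj) t ht)
    refine (h.smul (c := (n : ℝ)⁻¹) (by positivity)).congr fun t _ => ?_
    have hn' : (n : ℝ) ≠ 0 := by positivity
    simp only [trTriple, mpow_diagLine, diagonal_mul_diagonal, trace_diagonal, Finset.sum_const,
      Finset.card_univ, Fintype.card_fin, smul_eq_mul, nsmul_eq_mul, ← Complex.ofReal_mul,
      ← Complex.ofReal_natCast, Complex.ofReal_re]
    rw [div_self two_ne_zero, Real.rpow_one]
    field_simp
  refine ⟨mul_add_one_nonpos_of_convexOn fun x => ?_, mul_add_one_nonpos_of_convexOn fun x => ?_,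
    mul_add_one_nonpos_of_convexOn fun x => ?_⟩
  · obtain ⟨δ, hδ, -, h⟩ := key 1 (by simp) 0 (by simp) x
    exact ⟨δ, hδ, by simpa using h⟩
  · obtain ⟨δ, hδ, -, h⟩ := key 0 (by simp) 1 (by simp) x
    exact ⟨δ, hδ, by simpa using h⟩
  · obtain ⟨δ, hδ, hδ1, h⟩ := key 1 (by simp) 1 (by simp) x
    refine ⟨δ, hδ, h.congr fun t ht => ?_⟩
    simp only [mul_one]
    rw [Real.rpow_add (by linarith [ht.1])]

end Necessity

/-- Corollary 3.3, convex part: `(A,B,C) ↦ Tr[A^{q/2} B^p A^{q/2} C^r]` is jointly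
convex if and only if `q = 2`, `p, r < 0` and `−1 ≤ p + r < 0`. -/
theorem trace_triple_convex_iff (p q r : ℝ) (hp : p ≠ 0) (hq : q ≠ 0) (hr : r ≠ 0)
    (n : ℕ) (hn : 2 ≤ n) :
    JointlyConvex3 (trTriple (n := n) p q r) ↔
      (q = 2 ∧ p < 0 ∧ r < 0 ∧ -1 ≤ p + r ∧ p + r < 0) := by
  constructor
  · intro hf
    obtain rfl := eq_two_of_jointlyConvex3 hp hq hr hn hf
    obtain ⟨h1, h2, h3⟩ := exponents_of_jointlyConvex3 (by omega) hf
    have hp' : p < 0 := lt_of_le_of_ne (by nlinarith) hp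
    have hr' : r < 0 := lt_of_le_of_ne (by nlinarith) hr
    exact ⟨rfl, hp', hr', by nlinarith, by linarith⟩
  · rintro ⟨rfl, hp', hr', hpr, -⟩
    exact jointlyConvex3_trTriple_two hp'.le hr'.le hpr
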